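/- For every n ≥ 29 there exists a connected tricyclic graph G of order n with Sz*(G) = (n³ + 2n² − 16)/4 if n is even, and Sz*(G) = (n³ + 2n² − 18)/4 if n is odd. -/

import Mathlib

attribute [local instance] Classical.propDecidable

noncomputable def nC {V : Type*} [Fintype V] (G : SimpleGraph V) (u v : V) : ℕ :=
  (Finset.univ.filter fun w => G.dist u w < G.dist v w).card

noncomputable def nE {V : Type*} [Fintype V] (G : SimpleGraph V) (u v : V) : ℕ :=
  (Finset.univ.filter fun w => G.dist u w = G.dist v w).card

lemma nE_comm {V : Type*} [Fintype V] (G : SimpleGraph V) (u v : V) :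
    nE G u v = nE G v u := by
  unfold nE; congr 1; ext w; simp [eq_comm]

noncomputable def szContrib {V : Type*} [Fintype V] (G : SimpleGraph V) : Sym2 V → ℚ :=
  Sym2.lift ⟨fun u v =>
    ((nC G u v : ℚ) + (nE G u v : ℚ) / 2) * ((nC G v u : ℚ) + (nE G u v : ℚ) / 2),
    fun u v => by dsimp only; rw [nE_comm]; ring⟩

noncomputable def revSz {V : Type*} [Fintype V] (G : SimpleGraph V) : ℚ :=
  ∑ e ∈ G.edgeFinset, szContrib G e

/-! ### Recognising the distance function of a graph -/

theorem SimpleGraph.reachable_and_dist_eq {V : Type*} (G : SimpleGraph V) (d : V → V → ℕ)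
    (h_self : ∀ u, d u u = 0) (h_adj : ∀ u v w, G.Adj u v → d u w ≤ d v w + 1)
    (h_step : ∀ u w, u ≠ w → ∃ v, G.Adj u v ∧ d u w = d v w + 1) (u w : V) :
    G.Reachable u w ∧ G.dist u w = d u w := by
  have lower : ∀ {a b : V} (p : G.Walk a b), d a b ≤ p.length := by
    intro a b p
    induction p with
    | nil => simp [h_self]
    | @cons a b c hab p ih =>
      have := h_adj a b c hab
      rw [SimpleGraph.Walk.length_cons]
      omega
  have upper : ∀ (k : ℕ) (a : V), d a w = k → ∃ p : G.Walk a w, p.length = k := by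
    intro k
    induction k with
    | zero =>
      intro a ha
      by_cases haw : a = w
      · subst haw
        exact ⟨.nil, rfl⟩
      · obtain ⟨v, -, hv⟩ := h_step a w haw
        omega
    | succ k ih =>
      intro a ha
      have haw : a ≠ w := by
        rintro rfl
        rw [h_self] at ha
        omega
      obtain ⟨v, hav, hv⟩ := h_step a w haw
      obtain ⟨p, hp⟩ := ih v (by omega)
      exact ⟨.cons hav p, by simp [hp]⟩
  obtain ⟨p, hp⟩ := upper _ u rfl
  obtain ⟨q, hq⟩ := p.reachable.exists_walk_length_eq_dist
  refine ⟨p.reachable, le_antisymm (hp ▸ SimpleGraph.dist_le p) (hq ▸ lower q)⟩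

theorem nC_add_nC_add_nE {V : Type*} [Fintype V] (G : SimpleGraph V) (u v : V) :
    nC G u v + nC G v u + nE G u v = Fintype.card V := by
  unfold nC nE
  rw [← Finset.card_union_of_disjoint, ← Finset.card_union_of_disjoint, ← Finset.card_univ]
  · congr 1
    ext w
    simp only [Finset.mem_union, Finset.mem_filter, Finset.mem_univ, true_and, iff_true]
    omega
  · rw [Finset.disjoint_left]
    intro w
    simp only [Finset.mem_union, Finset.mem_filter, Finset.mem_univ, true_and]
    omega
  · rw [Finset.disjoint_left]
    intro w
    simp only [Finset.mem_filter, Finset.mem_univ, true_and]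
    omega

theorem szContrib_mk {V : Type*} [Fintype V] (G : SimpleGraph V) (u v : V) :
    szContrib G s(u, v) =
      ((Fintype.card V : ℚ) ^ 2 - ((nC G u v : ℚ) - (nC G v u : ℚ)) ^ 2) / 4 := by
  have h : ((nC G u v : ℚ) + nC G v u + nE G u v) = Fintype.card V := by
    exact_mod_cast nC_add_nC_add_nE G u v
  rw [← h]
  simp only [szContrib, Sym2.lift_mk]
  ring

/-! ### A cycle with two doubled vertices

The vertices `0, …, m - 1` form a cycle; `m` is a twin of `0` and `m + 1` is a twin of `h - 1`. -/

namespace TwinCycle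

/-- The vertex of the cycle of which `x` is a copy. -/
def proj (h m x : ℕ) : ℕ := if x = m then 0 else if x = m + 1 then h - 1 else x

/-- The distance on the cycle of length `m`. -/
def cyc (m i j : ℕ) : ℕ := min ((i - j) + (j - i)) (m - ((i - j) + (j - i)))

/-- The distance on the cycle of length `m` with twins added to `0` and `h - 1`. -/
def twinDist (h m x y : ℕ) : ℕ :=
  if x = y then 0 else if proj h m x = proj h m y then 2 else cyc m (proj h m x) (proj h m y)

theorem twinDist_comm (h m x y : ℕ) : twinDist h m x y = twinDist h m y x := by
  unfold twinDist cyc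
  split_ifs <;> omega

theorem proj_lt {h m x : ℕ} (hh : 2 ≤ h) (hm : h ≤ m) (hx : x < m + 2) : proj h m x < m := by
  unfold proj
  split_ifs <;> omega

/-- The cycle with two doubled vertices as a graph. -/
def graph (h m : ℕ) : SimpleGraph (Fin (m + 2)) where
  Adj x y := twinDist h m x y = 1
  symm := ⟨fun x y hxy => by rwa [twinDist_comm]⟩
  loopless := ⟨fun x hx => by simp [twinDist] at hx⟩

theorem twinDist_le {h m u v w : ℕ} (hh : 3 ≤ h) (hm : 2 * h ≤ m) (hu : u < m + 2)
    (hv : v < m + 2) (hw : w < m + 2) (huv : twinDist h m u v = 1) :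
    twinDist h m u w ≤ twinDist h m v w + 1 := by
  have hu' := proj_lt (h := h) (by omega) (by omega) hu
  have hv' := proj_lt (h := h) (by omega) (by omega) hv
  have hw' := proj_lt (h := h) (by omega) (by omega) hw
  have hvw : v = w → proj h m v = proj h m w := fun e => by rw [e]
  have huw : u = w → proj h m u = proj h m w := fun e => by rw [e]
  unfold twinDist cyc at *
  generalize proj h m u = a at *
  generalize proj h m v = b at *
  generalize proj h m w = c at *
  split_ifs at * <;> omega

theorem exists_twinDist_step {h m u w : ℕ} (hh : 3 ≤ h) (hm : 2 * h ≤ m) (hu : u < m + 2)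
    (hw : w < m + 2) (huw : u ≠ w) :
    ∃ v < m + 2, twinDist h m u v = 1 ∧ twinDist h m u w = twinDist h m v w + 1 := by
  have hu' := proj_lt (h := h) (by omega) (by omega) hu
  have hw' := proj_lt (h := h) (by omega) (by omega) hw
  have key : ∀ v < m, proj h m v = v := fun v hv => by
    unfold proj
    split_ifs <;> omega
  by_cases h1 : twinDist h m u w = 1
  · exact ⟨w, hw, h1, by rw [h1, twinDist, if_pos rfl]⟩
  by_contra! hno
  have hmem : ∀ v, v < m → cyc m (proj h m u) v = 1 →
      twinDist h m u w = cyc m v (proj h m w) + 1 → v = proj h m w := by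
    intro v hv h2 h3
    by_contra h4
    refine hno v (by omega) ?_ ?_
    · have : proj h m u ≠ v := by
        rintro rfl
        simp [cyc] at h2
      have huv : u ≠ v := by
        rintro rfl
        exact this (key u hv)
      simp [twinDist, huv, key v hv, this, h2]
    · have hvw : v ≠ w := by
        rintro rfl
        exact h4 (key v hv).symm
      rw [h3]
      simp [twinDist, hvw, key v hv, h4]
  have hs := hmem (if proj h m u + 1 = m then 0 else proj h m u + 1)
  have hp := hmem (if proj h m u = 0 then m - 1 else proj h m u - 1)
  clear hmem hno key
  unfold twinDist cyc at hs hp h1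
  rw [if_neg huw] at hs hp h1
  generalize proj h m u = a at *
  generalize proj h m w = c at *
  split_ifs at * <;> omega

theorem reachable_and_dist_graph {h m : ℕ} (hh : 3 ≤ h) (hm : 2 * h ≤ m) (u w : Fin (m + 2)) :
    (graph h m).Reachable u w ∧ (graph h m).dist u w = twinDist h m u w := by
  refine (graph h m).reachable_and_dist_eq (fun x y => twinDist h m x y) (by simp [twinDist])
    (fun u v w huv => twinDist_le hh hm u.2 v.2 w.2 huv) (fun u w huw => ?_) u w
  obtain ⟨v, hv, h1, h2⟩ := exists_twinDist_step hh hm u.2 w.2 (Fin.val_ne_of_ne huw)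
  exact ⟨⟨v, hv⟩, h1, h2⟩

/-! ### Counting the vertices closer to one end of an edge -/

/-- The number of vertices closer to `u` than to `v`. -/
def closer (h m u v : ℕ) : ℕ :=
  ((Finset.range (m + 2)).filter fun w => twinDist h m u w < twinDist h m v w).card

theorem nC_graph {h m : ℕ} (hh : 3 ≤ h) (hm : 2 * h ≤ m) (u v : Fin (m + 2)) :
    nC (graph h m) u v = closer h m u v := by
  unfold nC closer
  simp only [fun x y => (reachable_and_dist_graph hh hm x y).2]
  refine Finset.card_nbij (fun w => (w : ℕ)) ?_ ?_ ?_
  · intro w hw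
    simpa using hw
  · exact Fin.val_injective.injOn
  · intro w hw
    simp only [Finset.mem_coe, Finset.mem_filter, Finset.mem_range] at hw
    exact ⟨⟨w, hw.1⟩, by simpa using hw.2, rfl⟩

theorem twinDist_of_lt {h m x y : ℕ} (hx : x < m) (hy : y < m) : twinDist h m x y = cyc m x y := by
  unfold twinDist cyc proj
  split_ifs <;> omega

theorem closer_of_lt {h m u v : ℕ} (hu : u < m) (hv : v < m) :
    closer h m u v = ((Finset.range m).filter fun w => cyc m u w < cyc m v w).card
      + (if twinDist h m u m < twinDist h m v m then 1 else 0)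
      + (if twinDist h m u (m + 1) < twinDist h m v (m + 1) then 1 else 0) := by
  unfold closer
  simp only [Finset.card_filter, Finset.sum_range_succ]
  congr 2
  refine Finset.sum_congr rfl fun w hw => ?_
  rw [Finset.mem_range] at hw
  rw [twinDist_of_lt hu hw, twinDist_of_lt hv hw]

theorem card_cyc_lt {h m i j : ℕ} (hh : 3 ≤ h) (hm : m = 2 * h ∨ m = 2 * h + 1) (hi : i < m)
    (hj : j = if i + 1 = m then 0 else i + 1) :
    ((Finset.range m).filter fun w => cyc m i w < cyc m j w).card = h := by
  rw [← Finset.card_range h]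
  symm
  refine Finset.card_nbij' (fun k => if k ≤ i then i - k else i + m - k)
    (fun w => if w ≤ i then i - w else i + m - w) ?_ ?_ ?_ ?_ <;> intro w hw <;>
    simp only [Finset.mem_coe, Finset.mem_filter, Finset.mem_range] at hw ⊢ <;>
    (try unfold cyc at *) <;> split_ifs at * <;> omega

theorem card_cyc_gt {h m i j : ℕ} (hh : 3 ≤ h) (hm : m = 2 * h ∨ m = 2 * h + 1) (hi : i < m)
    (hj : j = if i + 1 = m then 0 else i + 1) :
    ((Finset.range m).filter fun w => cyc m j w < cyc m i w).card = h := by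
  rw [← Finset.card_range h]
  symm
  refine Finset.card_nbij' (fun k => if j + k < m then j + k else j + k - m)
    (fun w => if j ≤ w then w - j else w + m - j) ?_ ?_ ?_ ?_ <;> intro w hw <;>
    simp only [Finset.mem_coe, Finset.mem_filter, Finset.mem_range] at hw ⊢ <;>
    (try unfold cyc at *) <;> split_ifs at * <;> omega

/-- Exchanging a vertex with its twin preserves the counts. -/
theorem closer_swap {h m a b u v : ℕ} (hh : 3 ≤ h) (hm : 2 * h ≤ m)
    (hab : a = 0 ∧ b = m ∨ a = h - 1 ∧ b = m + 1) :
    closer h m (Equiv.swap a b u) (Equiv.swap a b v) = closer h m u v := by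
  have hproj : ∀ x, proj h m (Equiv.swap a b x) = proj h m x := by
    intro x
    rw [Equiv.swap_apply_def]
    unfold proj
    split_ifs <;> omega
  have hdist : ∀ x y, twinDist h m (Equiv.swap a b x) (Equiv.swap a b y) = twinDist h m x y := by
    intro x y
    simp only [twinDist, hproj, EmbeddingLike.apply_eq_iff_eq]
  have hlt : ∀ x, x < m + 2 → Equiv.swap a b x < m + 2 := by
    intro x hx
    rw [Equiv.swap_apply_def]
    split_ifs <;> omega
  unfold closer
  refine Finset.card_nbij' (Equiv.swap a b) (Equiv.swap a b) ?_ ?_ ?_ ?_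
  · intro w hw
    simp only [Finset.mem_coe, Finset.mem_filter, Finset.mem_range] at hw ⊢
    rw [← hdist u, ← hdist v, Equiv.swap_apply_self]
    exact ⟨hlt w hw.1, hw.2⟩
  · intro w hw
    simp only [Finset.mem_coe, Finset.mem_filter, Finset.mem_range] at hw ⊢
    rw [hdist, hdist]
    exact ⟨hlt w hw.1, hw.2⟩
  · intro w _
    exact Equiv.swap_apply_self a b w
  · intro w _
    exact Equiv.swap_apply_self a b w

/-! ### Enumerating the edges -/

/-- The first end of the `k`-th edge. -/
def src (h m k : ℕ) : ℕ := if k < m + 2 then k else if k = m + 2 then m - 1 else h - 2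

/-- The second end of the `k`-th edge. -/
def tgt (h m k : ℕ) : ℕ :=
  if k + 1 < m then k + 1 else if k + 1 = m then 0 else if k = m then 1
  else if k = m + 1 then h else if k = m + 2 then m else m + 1

theorem src_lt {h m k : ℕ} (hm : h ≤ m) : src h m k < m + 2 := by
  unfold src
  split_ifs <;> omega

theorem tgt_lt {h m k : ℕ} (hm : h ≤ m) : tgt h m k < m + 2 := by
  unfold tgt
  split_ifs <;> omega

theorem src_tgt_cases {h m k : ℕ} (hk : k < m + 4) :
    k + 1 < m ∧ src h m k = k ∧ tgt h m k = k + 1 ∨ k + 1 = m ∧ src h m k = k ∧ tgt h m k = 0 ∨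
    k = m ∧ src h m k = m ∧ tgt h m k = 1 ∨ k = m + 1 ∧ src h m k = m + 1 ∧ tgt h m k = h ∨
    k = m + 2 ∧ src h m k = m - 1 ∧ tgt h m k = m ∨
    k = m + 3 ∧ src h m k = h - 2 ∧ tgt h m k = m + 1 := by
  unfold src tgt
  rcases (by omega : k + 1 < m ∨ k + 1 = m ∨ k = m ∨ k = m + 1 ∨ k = m + 2 ∨ k = m + 3) with
    hk' | hk' | hk' | hk' | hk' | hk' <;> split_ifs <;> omega

theorem twinDist_eq_one_iff {h m x y : ℕ} (hh : 3 ≤ h) (hm : 2 * h ≤ m) (hxy : x < y)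
    (hy : y < m + 2) :
    twinDist h m x y = 1 ↔ y < m ∧ (y = x + 1 ∨ x = 0 ∧ y + 1 = m) ∨
      y = m ∧ (x = 1 ∨ x = m - 1) ∨ y = m + 1 ∧ (x = h ∨ x = h - 2) := by
  unfold twinDist cyc proj
  split_ifs <;> omega

theorem twinDist_src_tgt {h m k : ℕ} (hh : 3 ≤ h) (hm : 2 * h ≤ m) (hk : k < m + 4) :
    twinDist h m (src h m k) (tgt h m k) = 1 := by
  rcases lt_trichotomy (src h m k) (tgt h m k) with hlt | heq | hlt
  · rw [twinDist_eq_one_iff hh hm hlt (tgt_lt (by omega))]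
    have := src_tgt_cases (h := h) hk
    omega
  · have := src_tgt_cases (h := h) hk
    omega
  · rw [twinDist_comm, twinDist_eq_one_iff hh hm hlt (src_lt (by omega))]
    have := src_tgt_cases (h := h) hk
    omega

theorem exists_src_tgt {h m x y : ℕ} (hh : 3 ≤ h) (hm : 2 * h ≤ m) (hx : x < m + 2)
    (hy : y < m + 2) (hxy : twinDist h m x y = 1) :
    ∃ k < m + 4, src h m k = x ∧ tgt h m k = y ∨ src h m k = y ∧ tgt h m k = x := by
  wlog hlt : x < y generalizing x y
  · have hne : x ≠ y := by
      rintro rfl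
      simp [twinDist] at hxy
    obtain ⟨k, hk, h1⟩ := this hy hx (by rwa [twinDist_comm]) (by omega)
    exact ⟨k, hk, h1.symm⟩
  rw [twinDist_eq_one_iff hh hm hlt hy] at hxy
  have of_index : ∀ k < m + 4, (src h m k = x ∧ tgt h m k = y ∨ src h m k = y ∧ tgt h m k = x) →
      ∃ k < m + 4, src h m k = x ∧ tgt h m k = y ∨ src h m k = y ∧ tgt h m k = x :=
    fun k hk h1 => ⟨k, hk, h1⟩
  have edge_ends := fun k hk => src_tgt_cases (h := h) (m := m) (k := k) hk
  rcases hxy with ⟨h1, h2 | h2⟩ | ⟨h1, h2 | h2⟩ | ⟨h1, h2 | h2⟩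
  · exact of_index x (by omega) (by have := edge_ends x (by omega); omega)
  · exact of_index y (by omega) (by have := edge_ends y (by omega); omega)
  · exact of_index m (by omega) (by have := edge_ends m (by omega); omega)
  · exact of_index (m + 2) (by omega) (by have := edge_ends (m + 2) (by omega); omega)
  · exact of_index (m + 1) (by omega) (by have := edge_ends (m + 1) (by omega); omega)
  · exact of_index (m + 3) (by omega) (by have := edge_ends (m + 3) (by omega); omega)

theorem src_tgt_inj {h m k l : ℕ} (hh : 3 ≤ h) (hm : 2 * h ≤ m) (hk : k < m + 4) (hl : l < m + 4)
    (hkl : src h m k = src h m l ∧ tgt h m k = tgt h m l ∨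
      src h m k = tgt h m l ∧ tgt h m k = src h m l) : k = l := by
  rcases src_tgt_cases (h := h) hk with h1 | h1 | h1 | h1 | h1 | h1 <;>
  rcases src_tgt_cases (h := h) hl with h2 | h2 | h2 | h2 | h2 | h2 <;> omega

/-- The `k`-th edge. -/
def edge {h m : ℕ} (hm : h ≤ m) (k : ℕ) : Sym2 (Fin (m + 2)) :=
  s(⟨src h m k, src_lt hm⟩, ⟨tgt h m k, tgt_lt hm⟩)

theorem edge_injOn {h m : ℕ} (hh : 3 ≤ h) (hm : 2 * h ≤ m) :
    Set.InjOn (edge (h := h) (m := m) (by omega)) (Finset.range (m + 4)) := by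
  intro k hk l hl hkl
  simp only [Finset.coe_range, Set.mem_Iio] at hk hl
  simp only [edge, Sym2.eq_iff, Fin.mk.injEq] at hkl
  exact src_tgt_inj hh hm hk hl hkl

theorem edgeFinset_graph {h m : ℕ} (hh : 3 ≤ h) (hm : 2 * h ≤ m) :
    (graph h m).edgeFinset = (Finset.range (m + 4)).image (edge (h := h) (by omega)) := by
  ext e
  induction e with | _ x y =>
  simp only [SimpleGraph.mem_edgeFinset, SimpleGraph.mem_edgeSet, Finset.mem_image,
    Finset.mem_range, edge, Sym2.eq_iff, Fin.ext_iff]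
  refine ⟨fun hxy => exists_src_tgt hh hm x.2 y.2 hxy, ?_⟩
  rintro ⟨k, hk, ⟨hx, hy⟩ | ⟨hx, hy⟩⟩
  · have := twinDist_src_tgt hh hm hk
    rwa [hx, hy] at this
  · have := twinDist_src_tgt hh hm hk
    rw [hx, hy, twinDist_comm] at this
    exact this

/-! ### The imbalance of the edges -/

theorem sq_closer_sub_of_lt {h m k : ℕ} (hh : 5 ≤ h) (hm : m = 2 * h ∨ m = 2 * h + 1)
    (hk : k < m) :
    ((closer h m (src h m k) (tgt h m k) : ℚ) - closer h m (tgt h m k) (src h m k)) ^ 2 =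
      if k = 0 ∨ k = h - 2 then 4
      else if m = 2 * h + 1 ∧ (k = h ∨ k = m - 2) then 1 else 0 := by
  have hs : src h m k = k := by
    unfold src
    split_ifs <;> omega
  have ht : tgt h m k = if k + 1 = m then 0 else k + 1 := by
    unfold tgt
    split_ifs <;> omega
  have ht' : tgt h m k < m := by
    rw [ht]
    split_ifs <;> omega
  rw [hs, closer_of_lt hk ht', closer_of_lt ht' hk, card_cyc_lt (by omega) hm hk ht,
    card_cyc_gt (by omega) hm hk ht]
  have hj : k + 1 = m ∧ tgt h m k = 0 ∨ k + 1 < m ∧ tgt h m k = k + 1 := by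
    rw [ht]
    split_ifs <;> omega
  have hp : ∀ x < m, twinDist h m x m = if x = 0 then 2 else min x (m - x) := fun x hx => by
    unfold twinDist cyc proj
    split_ifs <;> omega
  have hq : ∀ x < m, twinDist h m x (m + 1) = if x = h - 1 then 2 else cyc m x (h - 1) :=
    fun x hx => by
      unfold twinDist cyc proj
      split_ifs <;> omega
  rw [hp k hk, hq k hk, hp _ ht', hq _ ht']
  generalize tgt h m k = j at hj
  clear hs ht ht' hp hq
  unfold cyc
  have h1 : (if k = 0 then 2 else min k (m - k)) < (if j = 0 then 2 else min j (m - j)) ↔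
      1 ≤ k ∧ k < h ∨ k + 1 = m := by
    split_ifs <;> omega
  have h2 : (if j = 0 then 2 else min j (m - j)) < (if k = 0 then 2 else min k (m - k)) ↔
      k = 0 ∨ m - h ≤ k ∧ k + 2 ≤ m := by
    clear h1
    split_ifs <;> omega
  have h3 : (if k = h - 1 then 2
        else min (k - (h - 1) + (h - 1 - k)) (m - (k - (h - 1) + (h - 1 - k)))) <
      (if j = h - 1 then 2 else min (j - (h - 1) + (h - 1 - j)) (m - (j - (h - 1) + (h - 1 - j)))) ↔
      k = h - 2 ∨ h ≤ k ∧ k ≤ 2 * h - 2 := by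
    clear h1 h2
    split_ifs <;> omega
  have h4 : (if j = h - 1 then 2
        else min (j - (h - 1) + (h - 1 - j)) (m - (j - (h - 1) + (h - 1 - j)))) <
      (if k = h - 1 then 2 else min (k - (h - 1) + (h - 1 - k)) (m - (k - (h - 1) + (h - 1 - k)))) ↔
      k + 2 < h ∨ k = h - 1 ∨ k + 1 = m := by
    clear h1 h2 h3
    split_ifs <;> omega
  simp only [h1, h2, h3, h4]
  clear h1 h2 h3 h4
  push_cast
  grind

theorem sq_closer_sub {h m k : ℕ} (hh : 5 ≤ h) (hm : m = 2 * h ∨ m = 2 * h + 1)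
    (hk : k < m + 4) :
    ((closer h m (src h m k) (tgt h m k) : ℚ) - closer h m (tgt h m k) (src h m k)) ^ 2 =
      if k = 0 ∨ k = h - 2 ∨ k = m ∨ k = m + 3 then 4
      else if m = 2 * h + 1 ∧ (k = h ∨ k = m - 2) then 1 else 0 := by
  have twin : ∀ {a b l : ℕ}, (a = 0 ∧ b = m ∨ a = h - 1 ∧ b = m + 1) →
      Equiv.swap a b (src h m l) = src h m k → Equiv.swap a b (tgt h m l) = tgt h m k →
      ((closer h m (src h m k) (tgt h m k) : ℚ) - closer h m (tgt h m k) (src h m k)) ^ 2 =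
      ((closer h m (src h m l) (tgt h m l) : ℚ) - closer h m (tgt h m l) (src h m l)) ^ 2 := by
    intro a b l hab h1 h2
    rw [← h1, ← h2, closer_swap (by omega) (by omega) hab, closer_swap (by omega) (by omega) hab]
  rcases (by omega : k < m ∨ k = m ∨ k = m + 1 ∨ k = m + 2 ∨ k = m + 3) with
    hk' | hk' | hk' | hk' | hk'
  · rw [sq_closer_sub_of_lt hh hm hk']
    grind
  · rw [twin (a := 0) (b := m) (l := 0) (by omega) (by grind [src]) (by grind [tgt]),
      sq_closer_sub_of_lt hh hm (by omega)]
    grind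
  · rw [twin (a := h - 1) (b := m + 1) (l := h - 1) (by omega) (by grind [src]) (by grind [tgt]),
      sq_closer_sub_of_lt hh hm (by omega)]
    grind
  · rw [twin (a := 0) (b := m) (l := m - 1) (by omega) (by grind [src]) (by grind [tgt]),
      sq_closer_sub_of_lt hh hm (by omega)]
    grind
  · rw [twin (a := h - 1) (b := m + 1) (l := h - 2) (by omega) (by grind [src]) (by grind [tgt]),
      sq_closer_sub_of_lt hh hm (by omega)]
    grind

theorem sum_sq_closer_sub {h m : ℕ} (hh : 5 ≤ h) (hm : m = 2 * h ∨ m = 2 * h + 1) :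
    ∑ k ∈ Finset.range (m + 4),
      ((closer h m (src h m k) (tgt h m k) : ℚ) - closer h m (tgt h m k) (src h m k)) ^ 2 =
      if m = 2 * h + 1 then 18 else 16 := by
  have indicators : ∀ k ∈ Finset.range (m + 4),
      ((closer h m (src h m k) (tgt h m k) : ℚ) - closer h m (tgt h m k) (src h m k)) ^ 2 =
      (if k = 0 then 4 else 0) + (if k = h - 2 then 4 else 0) + (if k = m then 4 else 0)
      + (if k = m + 3 then 4 else 0) + (if k = h then if m = 2 * h + 1 then 1 else 0 else 0)
      + (if k = m - 2 then if m = 2 * h + 1 then 1 else 0 else 0) := by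
    intro k hk
    rw [sq_closer_sub hh hm (Finset.mem_range.mp hk)]
    grind
  rw [Finset.sum_congr rfl indicators]
  simp only [Finset.sum_add_distrib, Finset.sum_ite_eq', Finset.mem_range]
  rw [if_pos (show 0 < m + 4 by omega), if_pos (show h - 2 < m + 4 by omega),
    if_pos (show m < m + 4 by omega), if_pos (show m + 3 < m + 4 by omega),
    if_pos (show h < m + 4 by omega), if_pos (show m - 2 < m + 4 by omega)]
  split_ifs <;> norm_num

theorem revSz_graph {h m : ℕ} (hh : 5 ≤ h) (hm : m = 2 * h ∨ m = 2 * h + 1) :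
    revSz (graph h m) =
      (((m + 2 : ℕ) : ℚ) ^ 2 * (m + 4 : ℕ) - if m = 2 * h + 1 then 18 else 16) / 4 := by
  have hm' : 2 * h ≤ m := by omega
  unfold revSz
  rw [edgeFinset_graph (by omega) hm', Finset.sum_image (edge_injOn (by omega) hm'),
    ← sum_sq_closer_sub hh hm]
  simp only [edge, szContrib_mk, nC_graph (show 3 ≤ h by omega) hm', Fintype.card_fin]
  rw [← Finset.sum_div, Finset.sum_sub_distrib, Finset.sum_const, Finset.card_range, nsmul_eq_mul,
    mul_comm]

end TwinCycle

/-- For every `n ≥ 29` there exists a connected tricyclic graph of order `n` whose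
revised Szeged index equals `(n³+2n²−16)/4` if `n` is even and `(n³+2n²−18)/4`
if `n` is odd. -/
theorem exists_tricyclic_extremal (n : ℕ) (hn : 29 ≤ n) :
    ∃ G : SimpleGraph (Fin n), G.Connected ∧ G.edgeFinset.card = n + 2 ∧
      revSz G = (if Even n then ((n : ℚ) ^ 3 + 2 * (n : ℚ) ^ 2 - 16) / 4
        else ((n : ℚ) ^ 3 + 2 * (n : ℚ) ^ 2 - 18) / 4) := by
  obtain ⟨m, rfl⟩ : ∃ m, n = m + 2 := ⟨n - 2, by omega⟩
  obtain ⟨h, hm⟩ : ∃ h, m = 2 * h ∨ m = 2 * h + 1 := ⟨m / 2, by omega⟩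
  refine ⟨TwinCycle.graph h m, ?_, ?_, ?_⟩
  · exact { preconnected := fun u w =>
      (TwinCycle.reachable_and_dist_graph (by omega) (by omega) u w).1 }
  · rw [TwinCycle.edgeFinset_graph (by omega) (by omega),
      Finset.card_image_of_injOn (TwinCycle.edge_injOn (by omega) (by omega)), Finset.card_range]
  · have hiff : Even (m + 2) ↔ ¬ m = 2 * h + 1 := by
      rw [Nat.even_iff]
      omega
    rw [TwinCycle.revSz_graph (by omega) hm]
    simp only [hiff, ite_not]
    split_ifs <;> push_cast <;> ring
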